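/- arXiv:1610.06747 — 7 statements merged into one kernel-verified Lean document; each statement's English description precedes it below -/
import Mathlib

section
/- Let U ⊆ ℝ³ be an open set, let n : U → ℝ³ be continuously differentiable with ‖n(x)‖ = 1 for all x ∈ U, let v : U → ℝ³ be twice continuously differentiable with ⟨n(x), v(x)⟩ = 0 for all x ∈ U, and let b : U → ℝ³ be a vector field differentiable at x₀ ∈ U. Define the covariant derivative along b by (D_b v)(x) := P_{n(x)}( Dv(x)[b(x)] ) and the directional derivative by (∂_b v)(x) := Dv(x)[b(x)]. Then for every a ∈ ℝ³: P_{n(x₀)}( D(D_b v)(x₀)[a] ) = P_{n(x₀)}( D(∂_b v)(x₀)[a] ) + ⟨Dn(x₀)[b(x₀)], v(x₀)⟩ · Dn(x₀)[a]. -/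
open scoped RealInnerProductSpace

/-- Tangential projection onto the plane orthogonal to a unit vector `m`:
`P_m x = x - ⟪m, x⟫ • m`. -/
noncomputable def tangProj (m x : EuclideanSpace ℝ (Fin 3)) : EuclideanSpace ℝ (Fin 3) :=
  x - ⟪m, x⟫ • m

/-- For a C¹ unit field `n`, a C² tangential field `v` on an open
`U ⊆ ℝ³`, and a vector field `b` differentiable at `x₀ ∈ U`, with covariant derivative
`(D_b v)(x) := P_{n x}(Dv(x)[b x])` and directional derivative `(∂_b v)(x) := Dv(x)[b x]`,
one has, for every direction `a`,
`P_{n x₀}(D(D_b v)(x₀)[a]) = P_{n x₀}(D(∂_b v)(x₀)[a]) + ⟪Dn(x₀)[b x₀], v x₀⟫ • Dn(x₀)[a]`. -/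
theorem proj_deriv_covariant_deriv
    (U : Set (EuclideanSpace ℝ (Fin 3))) (hU : IsOpen U)
    (n v b : EuclideanSpace ℝ (Fin 3) → EuclideanSpace ℝ (Fin 3))
    (hn : ∀ x ∈ U, ‖n x‖ = 1)
    (hv : ∀ x ∈ U, ⟪n x, v x⟫ = 0)
    (hn1 : ContDiffOn ℝ 1 n U)
    (hv2 : ContDiffOn ℝ 2 v U)
    (x₀ : EuclideanSpace ℝ (Fin 3)) (hx₀ : x₀ ∈ U)
    (hdb : DifferentiableAt ℝ b x₀)
    (a : EuclideanSpace ℝ (Fin 3)) :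
    tangProj (n x₀)
        (fderiv ℝ (fun x => tangProj (n x) (fderiv ℝ v x (b x))) x₀ a)
      = tangProj (n x₀) (fderiv ℝ (fun x => fderiv ℝ v x (b x)) x₀ a)
        + ⟪fderiv ℝ n x₀ (b x₀), v x₀⟫ • fderiv ℝ n x₀ a := by
  have hUx : U ∈ nhds x₀ := hU.mem_nhds hx₀
  have hnd : DifferentiableAt ℝ n x₀ :=
    (hn1.contDiffAt hUx).differentiableAt (by norm_num)
  have hvc := hv2.contDiffAt hUx
  have hvd : DifferentiableAt ℝ v x₀ := hvc.differentiableAt (by norm_num)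
  have hvd2 : DifferentiableAt ℝ (fderiv ℝ v) x₀ :=
    (hvc.fderiv_right (m := 1) (by norm_num)).differentiableAt (by norm_num)
  have hw : DifferentiableAt ℝ (fun x => fderiv ℝ v x (b x)) x₀ := hvd2.clm_apply hdb
  have h1 : ⟪n x₀, fderiv ℝ v x₀ (b x₀)⟫ + ⟪fderiv ℝ n x₀ (b x₀), v x₀⟫ = 0 := by
    have he : (fun x => ⟪n x, v x⟫) =ᶠ[nhds x₀] fun _ => (0 : ℝ) :=
      Filter.eventually_of_mem hUx hv
    have h := fderiv_inner_apply ℝ hnd hvd (b x₀)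
    rw [he.fderiv_eq] at h
    simpa using h.symm
  have h2 : ⟪n x₀, fderiv ℝ n x₀ a⟫ = 0 := by
    have he : (fun x => ⟪n x, n x⟫) =ᶠ[nhds x₀] fun _ => (1 : ℝ) :=
      Filter.eventually_of_mem hUx fun x hx => by
        simp [real_inner_self_eq_norm_sq, hn x hx]
    have h := fderiv_inner_apply ℝ hnd hnd a
    rw [he.fderiv_eq, real_inner_comm (n x₀) (fderiv ℝ n x₀ a)] at h
    simp at h
    linarith [real_inner_comm (n x₀) (fderiv ℝ n x₀ a)]
  have h3 : ⟪n x₀, n x₀⟫ = (1 : ℝ) := by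
    rw [real_inner_self_eq_norm_sq, hn x₀ hx₀]; norm_num
  have hi : DifferentiableAt ℝ (fun x => ⟪n x, fderiv ℝ v x (b x)⟫) x₀ := hnd.inner ℝ hw
  have h4 := (hw.hasFDerivAt.sub (hi.hasFDerivAt.smul hnd.hasFDerivAt)).fderiv
  have h5 : fderiv ℝ (fun x => tangProj (n x) (fderiv ℝ v x (b x))) x₀ a
      = fderiv ℝ (fun x => fderiv ℝ v x (b x)) x₀ a
        - (⟪n x₀, fderiv ℝ v x₀ (b x₀)⟫ • fderiv ℝ n x₀ a
          + (fderiv ℝ (fun x => ⟪n x, fderiv ℝ v x (b x)⟫) x₀ a) • n x₀) :=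
    DFunLike.congr_fun h4 a
  rw [h5, eq_neg_of_add_eq_zero_left h1]
  simp only [tangProj, inner_sub_right, inner_add_right, inner_smul_right, h2, h3]
  module
end

section
/- Let U ⊆ ℝ³ be an open set, let n : U → ℝ³ be continuously differentiable with ‖n(x)‖ = 1 for all x ∈ U, let v : U → ℝ³ be twice continuously differentiable with ⟨n(x), v(x)⟩ = 0 for all x ∈ U, and let a, b : U → ℝ³ be continuously differentiable tangential vector fields (⟨n(x), a(x)⟩ = 0 and ⟨n(x), b(x)⟩ = 0 for all x ∈ U). Define (D_c w)(x) := P_{n(x)}( Dw(x)[c(x)] ), the Lie bracket [a,b](x) := Db(x)[a(x)] − Da(x)[b(x)], and the Riemann curvature field R(a,b,v) := D_a(D_b v) − D_b(D_a v) − D_{[a,b]} v. Then at every x₀ ∈ U: R(a,b,v)(x₀) = ⟨Dn(x₀)[b(x₀)], v(x₀)⟩ · Dn(x₀)[a(x₀)] − ⟨Dn(x₀)[a(x₀)], v(x₀)⟩ · Dn(x₀)[b(x₀)]. In particular, writing κ := Dn(x₀), if κ is symmetric then R(a,b,v) = (b·κ·v) κ·a − (a·κ·v) κ·b. -/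
open scoped RealInnerProductSpace

/-- Covariant derivative of a field `w` along a field `c`, relative to the unit normal
field `n`: `(D_c w)(x) := P_{n x}(Dw(x)[c x])`. -/
noncomputable def covDeriv (n c w : EuclideanSpace ℝ (Fin 3) → EuclideanSpace ℝ (Fin 3))
    (x : EuclideanSpace ℝ (Fin 3)) : EuclideanSpace ℝ (Fin 3) :=
  tangProj (n x) (fderiv ℝ w x (c x))

/-- Second covariant derivative of a tangential field. -/
theorem covDeriv_covDeriv_aux
    (U : Set (EuclideanSpace ℝ (Fin 3))) (hU : IsOpen U)
    (n v b c : EuclideanSpace ℝ (Fin 3) → EuclideanSpace ℝ (Fin 3))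
    (hn : ∀ x ∈ U, ‖n x‖ = 1)
    (hv : ∀ x ∈ U, ⟪n x, v x⟫ = 0)
    (hn1 : ContDiffOn ℝ 1 n U)
    (hv2 : ContDiffOn ℝ 2 v U)
    (hb1 : ContDiffOn ℝ 1 b U)
    (x₀ : EuclideanSpace ℝ (Fin 3)) (hx₀ : x₀ ∈ U) :
    covDeriv n c (covDeriv n b v) x₀ =
      tangProj (n x₀) (fderiv ℝ v x₀ (fderiv ℝ b x₀ (c x₀))
        + fderiv ℝ (fderiv ℝ v) x₀ (c x₀) (b x₀))
      + ⟪fderiv ℝ n x₀ (b x₀), v x₀⟫ • fderiv ℝ n x₀ (c x₀) := by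
  have hmem : U ∈ nhds x₀ := hU.mem_nhds hx₀
  have dn : DifferentiableAt ℝ n x₀ := (hn1.contDiffAt hmem).differentiableAt (by norm_num)
  have db : DifferentiableAt ℝ b x₀ := (hb1.contDiffAt hmem).differentiableAt (by norm_num)
  have cv : ContDiffAt ℝ 2 v x₀ := hv2.contDiffAt hmem
  have dv : DifferentiableAt ℝ v x₀ := cv.differentiableAt (by norm_num)
  have ddv : DifferentiableAt ℝ (fderiv ℝ v) x₀ :=
    (cv.fderiv_right (m := 1) (by norm_num)).differentiableAt (by norm_num)
  have dw : DifferentiableAt ℝ (fun x => fderiv ℝ v x (b x)) x₀ := ddv.clm_apply db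
  have di : DifferentiableAt ℝ (fun x => ⟪n x, fderiv ℝ v x (b x)⟫) x₀ := dn.inner ℝ dw
  have hnn : ⟪n x₀, n x₀⟫ = 1 := by
    rw [real_inner_self_eq_norm_sq, hn x₀ hx₀]; norm_num
  have h1 : ∀ y, ⟪n x₀, fderiv ℝ v x₀ y⟫ + ⟪fderiv ℝ n x₀ y, v x₀⟫ = 0 := by
    intro y
    rw [← fderiv_inner_apply ℝ dn dv y]
    have : (fun x => ⟪n x, v x⟫) =ᶠ[nhds x₀] fun _ => (0 : ℝ) := by
      filter_upwards [hmem] with x hx using hv x hx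
    rw [this.fderiv_eq]; simp
  have h2 : ∀ y, ⟪n x₀, fderiv ℝ n x₀ y⟫ = 0 := by
    intro y
    have h := fderiv_inner_apply ℝ dn dn y
    have : (fun x => ⟪n x, n x⟫) =ᶠ[nhds x₀] fun _ => (1 : ℝ) := by
      filter_upwards [hmem] with x hx
      rw [real_inner_self_eq_norm_sq, hn x hx]; norm_num
    rw [this.fderiv_eq, real_inner_comm (n x₀) (fderiv ℝ n x₀ y)] at h
    simp at h
    linarith
  have key : fderiv ℝ (covDeriv n b v) x₀ (c x₀) =
      (fderiv ℝ v x₀ (fderiv ℝ b x₀ (c x₀)) + fderiv ℝ (fderiv ℝ v) x₀ (c x₀) (b x₀))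
      - (⟪n x₀, fderiv ℝ v x₀ (b x₀)⟫ • fderiv ℝ n x₀ (c x₀)
        + fderiv ℝ (fun x => ⟪n x, fderiv ℝ v x (b x)⟫) x₀ (c x₀) • n x₀) := by
    have e : covDeriv n b v = fun x =>
      fderiv ℝ v x (b x) - ⟪n x, fderiv ℝ v x (b x)⟫ • n x := rfl
    rw [e, fderiv_fun_sub dw (di.fun_smul dn), fderiv_fun_smul di dn, fderiv_clm_apply ddv db]
    simp
  have h3 : ⟪fderiv ℝ n x₀ (b x₀), v x₀⟫ = - ⟪n x₀, fderiv ℝ v x₀ (b x₀)⟫ := by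
    linarith [h1 (b x₀)]
  rw [covDeriv, key, h3]
  simp only [tangProj, inner_sub_right, inner_add_right, inner_smul_right, h2, hnn]
  module

/-- Riemann curvature of an embedded codimension-one surface via the
Weingarten map: for a C¹ unit field `n`, a C² tangential field `v`, and C¹ tangential
fields `a, b` on an open `U ⊆ ℝ³`, the curvature field
`R(a,b,v) := D_a(D_b v) - D_b(D_a v) - D_{[a,b]} v`, with Lie bracket
`[a,b](x) := Db(x)[a x] - Da(x)[b x]`, satisfies at every `x₀ ∈ U`:
`R(a,b,v)(x₀) = ⟪Dn(x₀)[b x₀], v x₀⟫ • Dn(x₀)[a x₀] - ⟪Dn(x₀)[a x₀], v x₀⟫ • Dn(x₀)[b x₀]`. -/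
theorem riemann_curvature_embedded_surface
    (U : Set (EuclideanSpace ℝ (Fin 3))) (hU : IsOpen U)
    (n v a b : EuclideanSpace ℝ (Fin 3) → EuclideanSpace ℝ (Fin 3))
    (hn : ∀ x ∈ U, ‖n x‖ = 1)
    (hv : ∀ x ∈ U, ⟪n x, v x⟫ = 0)
    (ha : ∀ x ∈ U, ⟪n x, a x⟫ = 0)
    (hb : ∀ x ∈ U, ⟪n x, b x⟫ = 0)
    (hn1 : ContDiffOn ℝ 1 n U)
    (hv2 : ContDiffOn ℝ 2 v U)
    (ha1 : ContDiffOn ℝ 1 a U)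
    (hb1 : ContDiffOn ℝ 1 b U)
    (x₀ : EuclideanSpace ℝ (Fin 3)) (hx₀ : x₀ ∈ U) :
    covDeriv n a (covDeriv n b v) x₀ - covDeriv n b (covDeriv n a v) x₀
      - covDeriv n (fun x => fderiv ℝ b x (a x) - fderiv ℝ a x (b x)) v x₀
      = ⟪fderiv ℝ n x₀ (b x₀), v x₀⟫ • fderiv ℝ n x₀ (a x₀)
        - ⟪fderiv ℝ n x₀ (a x₀), v x₀⟫ • fderiv ℝ n x₀ (b x₀) := by
  have hs : IsSymmSndFDerivAt ℝ v x₀ :=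
    (hv2.contDiffAt (hU.mem_nhds hx₀)).isSymmSndFDerivAt (by simp)
  rw [covDeriv_covDeriv_aux U hU n v b a hn hv hn1 hv2 hb1 x₀ hx₀,
    covDeriv_covDeriv_aux U hU n v a b hn hv hn1 hv2 ha1 x₀ hx₀, hs (b x₀) (a x₀)]
  simp only [covDeriv, tangProj, map_sub, inner_sub_right, inner_add_right]
  module
end

section
/- Let K : ℝ³ → ℝ³ be a symmetric linear map (⟨K x, y⟩ = ⟨x, K y⟩ for all x, y), let {t₁, t₂, n} be an orthonormal basis of ℝ³ with K n = 0, and let v ∈ ℝ³ with ⟨n, v⟩ = 0. Suppose ⟨b, K v⟩ · K a = ⟨a, K v⟩ · K b for all a, b ∈ ℝ³, and suppose the Gauss curvature is nonzero: ⟨t₁, K t₁⟩⟨t₂, K t₂⟩ − ⟨t₁, K t₂⟩² ≠ 0. Then v = 0. -/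
open scoped RealInnerProductSpace

/-- Let `K` be a symmetric linear map on ℝ³, let `{t₁, t₂, n}` be an
orthonormal basis with `K n = 0`, and let `v` be tangential (`⟪n, v⟫ = 0`). If the
algebraic Riemann curvature vanishes on `v`, i.e. `⟪b, K v⟫ • K a = ⟪a, K v⟫ • K b` for
all `a, b`, and the Gauss curvature `⟪t₁,K t₁⟫⟪t₂,K t₂⟫ - ⟪t₁,K t₂⟫²` is nonzero, then
`v = 0`. -/
theorem tangential_vector_vanishes_of_riemann_zero
    (K : EuclideanSpace ℝ (Fin 3) →ₗ[ℝ] EuclideanSpace ℝ (Fin 3))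
    (hK : ∀ x y : EuclideanSpace ℝ (Fin 3), ⟪K x, y⟫ = ⟪x, K y⟫)
    (t₁ t₂ n : EuclideanSpace ℝ (Fin 3))
    (ht₁ : ‖t₁‖ = 1) (ht₂ : ‖t₂‖ = 1) (hn : ‖n‖ = 1)
    (ht₁₂ : ⟪t₁, t₂⟫ = 0) (ht₁n : ⟪t₁, n⟫ = 0) (ht₂n : ⟪t₂, n⟫ = 0)
    (hKn : K n = 0)
    (v : EuclideanSpace ℝ (Fin 3)) (hv : ⟪n, v⟫ = 0)
    (hR : ∀ a b : EuclideanSpace ℝ (Fin 3), ⟪b, K v⟫ • K a = ⟪a, K v⟫ • K b)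
    (hGauss : ⟪t₁, K t₁⟫ * ⟪t₂, K t₂⟫ - ⟪t₁, K t₂⟫ ^ 2 ≠ 0) :
    v = 0 := by
  have hon : Orthonormal ℝ ![t₁, t₂, n] := by
    have h21 : ⟪t₂, t₁⟫ = 0 := by rw [real_inner_comm]; exact ht₁₂
    have hn1 : ⟪n, t₁⟫ = 0 := by rw [real_inner_comm]; exact ht₁n
    have hn2 : ⟪n, t₂⟫ = 0 := by rw [real_inner_comm]; exact ht₂n
    constructor
    · intro i
      fin_cases i <;> simp [ht₁, ht₂, hn]
    · intro i j hij
      fin_cases i <;> fin_cases j <;> simp_all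
  have hspan : ⊤ ≤ Submodule.span ℝ (Set.range ![t₁, t₂, n]) :=
    (hon.linearIndependent.span_eq_top_of_card_eq_finrank (by simp)).ge
  have hexp : v = ⟪t₁, v⟫ • t₁ + ⟪t₂, v⟫ • t₂ := by
    have h := (OrthonormalBasis.mk hon hspan).sum_repr' v
    simp [Fin.sum_univ_three, hv] at h
    exact h.symm
  have hb : ⟪t₂, K t₁⟫ = ⟪t₁, K t₂⟫ := by rw [← hK, real_inner_comm]
  have hKv : K v = ⟪t₁, v⟫ • K t₁ + ⟪t₂, v⟫ • K t₂ := by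
    conv_lhs => rw [hexp]
    simp
  have hp : ⟪t₁, K v⟫ = ⟪t₁, v⟫ * ⟪t₁, K t₁⟫ + ⟪t₂, v⟫ * ⟪t₁, K t₂⟫ := by
    rw [hKv, inner_add_right, real_inner_smul_right, real_inner_smul_right]
  have hq : ⟪t₂, K v⟫ = ⟪t₁, v⟫ * ⟪t₁, K t₂⟫ + ⟪t₂, v⟫ * ⟪t₂, K t₂⟫ := by
    rw [hKv, inner_add_right, real_inner_smul_right, real_inner_smul_right, hb]
  have h1 := congrArg (fun w => ⟪t₁, w⟫) (hR t₁ t₂)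
  have h2 := congrArg (fun w => ⟪t₂, w⟫) (hR t₁ t₂)
  simp only [real_inner_smul_right, hb] at h1 h2
  have hp0 : ⟪t₁, K v⟫ = 0 := by
    refine (mul_eq_zero.mp ?_).resolve_right hGauss
    linear_combination ⟪t₁, K t₂⟫ * h1 - ⟪t₁, K t₁⟫ * h2
  have hq0 : ⟪t₂, K v⟫ = 0 := by
    refine (mul_eq_zero.mp ?_).resolve_right hGauss
    linear_combination ⟪t₂, K t₂⟫ * h1 - ⟪t₁, K t₂⟫ * h2
  rw [hp] at hp0
  rw [hq] at hq0
  have hx : ⟪t₁, v⟫ = 0 := by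
    refine (mul_eq_zero.mp ?_).resolve_right hGauss
    linear_combination ⟪t₂, K t₂⟫ * hp0 - ⟪t₁, K t₂⟫ * hq0
  have hy : ⟪t₂, v⟫ = 0 := by
    refine (mul_eq_zero.mp ?_).resolve_right hGauss
    linear_combination ⟪t₁, K t₁⟫ * hq0 - ⟪t₁, K t₂⟫ * hp0
  rw [hexp, hx, hy]
  simp
end

section
/- Let n, n_h ∈ ℝ³ be unit vectors, let A : ℝ³ → ℝ³ be a continuous linear map with operator norm ‖A‖, and let ξ ∈ ℝ³ satisfy ⟨n_h, ξ⟩ = 0. Then ‖P_n(ξ − A ξ)‖ ≥ (1 − ‖n − n_h‖ − ‖A‖) · ‖ξ‖. -/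
open scoped RealInnerProductSpace

/-- Pointwise coercivity of the map `B = P(I - A)P_h`: for unit vectors
`n, n_h`, a continuous linear map `A`, and `ξ` with `⟪n_h, ξ⟫ = 0`,
`‖P_n(ξ - A ξ)‖ ≥ (1 - ‖n - n_h‖ - ‖A‖) ‖ξ‖`. -/
theorem coercivity_B
    (n n_h : EuclideanSpace ℝ (Fin 3))
    (hn : ‖n‖ = 1) (hnh : ‖n_h‖ = 1)
    (A : EuclideanSpace ℝ (Fin 3) →L[ℝ] EuclideanSpace ℝ (Fin 3))
    (ξ : EuclideanSpace ℝ (Fin 3)) (hξ : ⟪n_h, ξ⟫ = 0) :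
    (1 - ‖n - n_h‖ - ‖A‖) * ‖ξ‖ ≤ ‖tangProj n (ξ - A ξ)‖ := by
  have hproj : ∀ y : EuclideanSpace ℝ (Fin 3), ‖y - ⟪n, y⟫ • n‖ ≤ ‖y‖ := by
    intro y
    have h : ‖y - ⟪n, y⟫ • n‖ ^ 2 = ‖y‖ ^ 2 - ⟪n, y⟫ ^ 2 := by
      rw [norm_sub_sq_real, real_inner_smul_right, norm_smul, hn, real_inner_comm y n,
        Real.norm_eq_abs, mul_one, sq_abs, real_inner_comm]
      ring
    exact abs_le_of_sq_le_sq' (by nlinarith [sq_nonneg ⟪n, y⟫]) (norm_nonneg _) |>.2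
  have hinner : ‖⟪n, ξ⟫ • n‖ ≤ ‖n - n_h‖ * ‖ξ‖ := by
    have h : ⟪n, ξ⟫ = ⟪n - n_h, ξ⟫ := by rw [inner_sub_left, hξ, sub_zero]
    rw [norm_smul, hn, mul_one, h]
    exact norm_inner_le_norm _ _
  have hA := (hproj (A ξ)).trans (A.le_opNorm ξ)
  have hdec : ξ = tangProj n (ξ - A ξ) + ⟪n, ξ⟫ • n + (A ξ - ⟪n, A ξ⟫ • n) := by
    rw [tangProj, inner_sub_right, sub_smul]
    abel
  have htri : ‖ξ‖ ≤ ‖tangProj n (ξ - A ξ)‖ + ‖⟪n, ξ⟫ • n‖ + ‖A ξ - ⟪n, A ξ⟫ • n‖ := by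
    conv_lhs => rw [hdec]
    exact norm_add₃_le
  linarith
end

section
/- Let n, n_h ∈ ℝ³ be unit vectors and let η ∈ ℝ³ satisfy ⟨n, η⟩ = 0. Then ‖P_n( ⟨n_h, η⟩ · n_h )‖ ≤ ‖n − n_h‖² · ‖η‖. -/
open scoped RealInnerProductSpace

/-- Quadratic-order estimate `‖P Q_h P η‖ ≤ ‖n - n_h‖² ‖η‖`: for unit
vectors `n, n_h` and `η` with `⟪n, η⟫ = 0`,
`‖P_n(⟪n_h, η⟫ • n_h)‖ ≤ ‖n - n_h‖² ‖η‖`. -/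
theorem proj_normal_proj_quadratic_bound
    (n n_h : EuclideanSpace ℝ (Fin 3))
    (hn : ‖n‖ = 1) (hnh : ‖n_h‖ = 1)
    (η : EuclideanSpace ℝ (Fin 3)) (hη : ⟪n, η⟫ = 0) :
    ‖tangProj n (⟪n_h, η⟫ • n_h)‖ ≤ ‖n - n_h‖ ^ 2 * ‖η‖ := by
  have e : tangProj n (⟪n_h, η⟫ • n_h) = ⟪n_h, η⟫ • (n_h - ⟪n, n_h⟫ • n) := by
    rw [tangProj, inner_smul_right, smul_sub, smul_smul]
  have h1 : |⟪n_h, η⟫| ≤ ‖n - n_h‖ * ‖η‖ := by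
    have h := abs_real_inner_le_norm (n - n_h) η
    rwa [inner_sub_left, hη, zero_sub, abs_neg] at h
  have h2 : ‖n_h - ⟪n, n_h⟫ • n‖ ≤ ‖n - n_h‖ := by
    refine (sq_le_sq₀ (norm_nonneg _) (norm_nonneg _)).1 ?_
    rw [@norm_sub_sq_real, @norm_sub_sq_real, inner_smul_right, norm_smul, hn, hnh,
      real_inner_comm n n_h, Real.norm_eq_abs, mul_one, sq_abs]
    nlinarith [sq_nonneg (⟪n, n_h⟫ - 1)]
  rw [e, norm_smul, Real.norm_eq_abs]
  calc |⟪n_h, η⟫| * ‖n_h - ⟪n, n_h⟫ • n‖ ≤ (‖n - n_h‖ * ‖η‖) * ‖n - n_h‖ := by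
        gcongr
    _ = ‖n - n_h‖ ^ 2 * ‖η‖ := by ring
end

section
/- Let n, n_h ∈ ℝ³ be unit vectors and let A : ℝ³ → ℝ³ be a continuous linear map with ‖n − n_h‖ + ‖A‖ < 1 (operator norm). Then for every η ∈ ℝ³ with ⟨n, η⟩ = 0 there exists a unique ξ ∈ ℝ³ with ⟨n_h, ξ⟩ = 0 such that P_n(ξ − A ξ) = η; moreover this ξ satisfies ‖ξ − P_{n_h} η‖ ≤ ((‖n − n_h‖² + ‖A‖) / (1 − ‖n − n_h‖ − ‖A‖)) · ‖η‖. -/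
open scoped RealInnerProductSpace

theorem tangProj_norm_le (m x : EuclideanSpace ℝ (Fin 3)) (hm : ‖m‖ = 1) : ‖tangProj m x‖ ≤ ‖x‖ := by
  have h : ‖tangProj m x‖ ^ 2 = ‖x‖ ^ 2 - ⟪m, x⟫ ^ 2 := by
    unfold tangProj
    rw [norm_sub_sq_real, inner_smul_right, norm_smul, hm, real_inner_comm, mul_one,
      Real.norm_eq_abs, sq_abs]
    ring
  refine (sq_le_sq₀ (norm_nonneg _) (norm_nonneg _)).mp ?_
  nlinarith [sq_nonneg ⟪m, x⟫]

theorem tangProj_inner (m x : EuclideanSpace ℝ (Fin 3)) (hm : ‖m‖ = 1) : ⟪m, tangProj m x⟫ = 0 := by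
  unfold tangProj
  rw [inner_sub_right, inner_smul_right, real_inner_self_eq_norm_sq, hm]
  ring

theorem tangProj_sub (m x y : EuclideanSpace ℝ (Fin 3)) : tangProj m (x - y) = tangProj m x - tangProj m y := by
  unfold tangProj
  rw [inner_sub_right, sub_smul]
  abel

theorem tangProj_smul (m : EuclideanSpace ℝ (Fin 3)) (c : ℝ) (x : EuclideanSpace ℝ (Fin 3)) : tangProj m (c • x) = c • tangProj m x := by
  unfold tangProj
  rw [inner_smul_right, smul_sub, smul_smul]

theorem tangProj_add (m x y : EuclideanSpace ℝ (Fin 3)) : tangProj m (x + y) = tangProj m x + tangProj m y := by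
  unfold tangProj
  rw [inner_add_right, add_smul]
  abel

theorem inner_bound (n n_h ξ : EuclideanSpace ℝ (Fin 3)) (h : ⟪n_h, ξ⟫ = 0) : |⟪n, ξ⟫| ≤ ‖n - n_h‖ * ‖ξ‖ := by
  have : ⟪n, ξ⟫ = ⟪n - n_h, ξ⟫ := by rw [inner_sub_left, h, sub_zero]
  rw [this]
  exact abs_real_inner_le_norm _ _

theorem coercive (n n_h : EuclideanSpace ℝ (Fin 3)) (hn : ‖n‖ = 1) (A : EuclideanSpace ℝ (Fin 3) →L[ℝ] EuclideanSpace ℝ (Fin 3)) (ξ : EuclideanSpace ℝ (Fin 3)) (h : ⟪n_h, ξ⟫ = 0) :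
    (1 - ‖n - n_h‖ - ‖A‖) * ‖ξ‖ ≤ ‖tangProj n (ξ - A ξ)‖ := by
  have e : ξ = tangProj n (ξ - A ξ) + ⟪n, ξ⟫ • n + tangProj n (A ξ) := by
    rw [tangProj_sub]
    unfold tangProj
    abel
  have h1 : ‖ξ‖ ≤ ‖tangProj n (ξ - A ξ)‖ + ‖⟪n, ξ⟫ • n‖ + ‖tangProj n (A ξ)‖ := by
    conv_lhs => rw [e]
    exact norm_add₃_le
  have h2 := inner_bound n n_h ξ h
  rw [norm_smul, hn, mul_one, Real.norm_eq_abs] at h1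
  have h3 := (tangProj_norm_le n (A ξ) hn).trans (A.le_opNorm ξ)
  linarith

theorem err_bound (n n_h : EuclideanSpace ℝ (Fin 3)) (hn : ‖n‖ = 1) (hnh : ‖n_h‖ = 1) (A : EuclideanSpace ℝ (Fin 3) →L[ℝ] EuclideanSpace ℝ (Fin 3)) (ξ : EuclideanSpace ℝ (Fin 3))
    (h : ⟪n_h, ξ⟫ = 0) :
    ‖ξ - tangProj n_h (tangProj n (ξ - A ξ))‖ ≤ (‖n - n_h‖ ^ 2 + ‖A‖) * ‖ξ‖ := by
  have z : tangProj n_h n_h = 0 := by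
    unfold tangProj
    rw [real_inner_self_eq_norm_sq, hnh]
    simp
  have zx : tangProj n_h ξ = ξ := by
    unfold tangProj
    rw [h]
    simp
  have e : ξ - tangProj n_h (tangProj n (ξ - A ξ)) =
      ⟪n, ξ⟫ • tangProj n_h (n - n_h) + tangProj n_h (tangProj n (A ξ)) := by
    rw [tangProj_sub n, tangProj_sub n_h, tangProj_sub n_h n, z, sub_zero]
    have : tangProj n ξ = ξ - ⟪n, ξ⟫ • n := rfl
    rw [this, tangProj_sub, tangProj_smul, zx]
    abel
  rw [e]
  refine (norm_add_le _ _).trans ?_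
  rw [norm_smul, Real.norm_eq_abs]
  have h2 := inner_bound n n_h ξ h
  have h4 := tangProj_norm_le n_h (n - n_h) hnh
  have h3 := (tangProj_norm_le n_h _ hnh).trans
    ((tangProj_norm_le n (A ξ) hn).trans (A.le_opNorm ξ))
  have h5 := mul_le_mul h2 h4 (norm_nonneg _) (by positivity)
  linarith

/-- Invertibility of `B = P(I - A)P_h` from the discrete tangent plane
to the exact tangent plane, with a quantitative bound on `B⁻¹ - P_h P`: if `n, n_h` are
unit vectors and `A` is a continuous linear map with `‖n - n_h‖ + ‖A‖ < 1`, then for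
every `η` with `⟪n, η⟫ = 0` there is a unique `ξ` with `⟪n_h, ξ⟫ = 0` and
`P_n(ξ - A ξ) = η`; moreover every such `ξ` satisfies
`‖ξ - P_{n_h} η‖ ≤ ((‖n - n_h‖² + ‖A‖)/(1 - ‖n - n_h‖ - ‖A‖)) ‖η‖`. -/
theorem B_invertible_and_inverse_bound
    (n n_h : EuclideanSpace ℝ (Fin 3))
    (hn : ‖n‖ = 1) (hnh : ‖n_h‖ = 1)
    (A : EuclideanSpace ℝ (Fin 3) →L[ℝ] EuclideanSpace ℝ (Fin 3))
    (hsmall : ‖n - n_h‖ + ‖A‖ < 1)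
    (η : EuclideanSpace ℝ (Fin 3)) (hη : ⟪n, η⟫ = 0) :
    (∃! ξ : EuclideanSpace ℝ (Fin 3),
        ⟪n_h, ξ⟫ = 0 ∧ tangProj n (ξ - A ξ) = η) ∧
    ∀ ξ : EuclideanSpace ℝ (Fin 3), ⟪n_h, ξ⟫ = 0 → tangProj n (ξ - A ξ) = η →
      ‖ξ - tangProj n_h η‖ ≤
        ((‖n - n_h‖ ^ 2 + ‖A‖) / (1 - ‖n - n_h‖ - ‖A‖)) * ‖η‖ := by
  have hpos : 0 < 1 - ‖n - n_h‖ - ‖A‖ := by linarith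
  have inj0 : ∀ ξ : EuclideanSpace ℝ (Fin 3), ⟪n_h, ξ⟫ = 0 → tangProj n (ξ - A ξ) = 0 →
      ξ = 0 := by
    intro ξ h1 h2
    have h := coercive n n_h hn A ξ h1
    rw [h2, norm_zero] at h
    have : ‖ξ‖ ≤ 0 := by
      by_contra! hc
      linarith [mul_pos hpos hc]
    exact norm_le_zero_iff.mp this
  let T : EuclideanSpace ℝ (Fin 3) →ₗ[ℝ] EuclideanSpace ℝ (Fin 3) :=
    { toFun := fun ξ => tangProj n (ξ - A ξ) + ⟪n_h, ξ⟫ • n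
      map_add' := by
        intro x y
        rw [map_add, inner_add_right, add_smul, add_sub_add_comm, tangProj_add]
        abel
      map_smul' := by
        intro c x
        rw [map_smul, inner_smul_right, ← smul_sub, tangProj_smul, RingHom.id_apply, smul_add,
          smul_smul] }
  have hT : ∀ ξ, T ξ = tangProj n (ξ - A ξ) + ⟪n_h, ξ⟫ • n := fun _ => rfl
  have hin : ∀ ξ, ⟪n, T ξ⟫ = ⟪n_h, ξ⟫ := by
    intro ξ
    rw [hT, inner_add_right, tangProj_inner n _ hn, inner_smul_right,
      real_inner_self_eq_norm_sq, hn]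
    ring
  have hinj : Function.Injective T := by
    rw [injective_iff_map_eq_zero]
    intro ξ h
    have h1 : ⟪n_h, ξ⟫ = 0 := by rw [← hin, h, inner_zero_right]
    rw [hT, h1, zero_smul, add_zero] at h
    exact inj0 ξ h1 h
  refine ⟨?_, ?_⟩
  · obtain ⟨ξ, hξ⟩ := LinearMap.injective_iff_surjective.mp hinj η
    have h1 : ⟪n_h, ξ⟫ = 0 := by rw [← hin, hξ, hη]
    refine ⟨ξ, ⟨h1, ?_⟩, ?_⟩
    · rw [hT, h1, zero_smul, add_zero] at hξ
      exact hξ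
    · rintro y ⟨hy1, hy2⟩
      apply hinj
      rw [hξ, hT, hy1, hy2, zero_smul, add_zero]
  · intro ξ h1 h2
    have hc := coercive n n_h hn A ξ h1
    have he := err_bound n n_h hn hnh A ξ h1
    rw [h2] at hc he
    refine he.trans ?_
    rw [div_mul_eq_mul_div, le_div_iff₀ hpos, mul_assoc]
    apply mul_le_mul_of_nonneg_left _ (by positivity)
    linarith
end

section
/- Let U ⊆ ℝ³ be an open set, let n : U → ℝ³ satisfy ‖n(x)‖ = 1 for all x ∈ U, and let v : U → ℝ³ satisfy ⟨n(x), v(x)⟩ = 0 for all x ∈ U. If n and v are differentiable at x₀ ∈ U, then for every direction a ∈ ℝ³, ‖Dv(x₀)[a]‖ ≤ ‖P_{n(x₀)}( Dv(x₀)[a] )‖ + ‖Dn(x₀)[a]‖ · ‖v(x₀)‖. -/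
open scoped RealInnerProductSpace

/-- The full derivative of a tangential field is controlled by its
covariant derivative plus a curvature term: if `n` is a unit field and `v` a tangential
field on an open `U ⊆ ℝ³`, both differentiable at `x₀ ∈ U`, then for every direction `a`,
`‖Dv(x₀)[a]‖ ≤ ‖P_{n x₀}(Dv(x₀)[a])‖ + ‖Dn(x₀)[a]‖ ‖v x₀‖`. -/
theorem full_deriv_le_covariant_plus_curvature
    (U : Set (EuclideanSpace ℝ (Fin 3))) (hU : IsOpen U)
    (n v : EuclideanSpace ℝ (Fin 3) → EuclideanSpace ℝ (Fin 3))
    (hn : ∀ x ∈ U, ‖n x‖ = 1)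
    (hv : ∀ x ∈ U, ⟪n x, v x⟫ = 0)
    (x₀ : EuclideanSpace ℝ (Fin 3)) (hx₀ : x₀ ∈ U)
    (hdn : DifferentiableAt ℝ n x₀) (hdv : DifferentiableAt ℝ v x₀)
    (a : EuclideanSpace ℝ (Fin 3)) :
    ‖fderiv ℝ v x₀ a‖ ≤
      ‖tangProj (n x₀) (fderiv ℝ v x₀ a)‖ + ‖fderiv ℝ n x₀ a‖ * ‖v x₀‖ := by
  have h0 : fderiv ℝ (fun x => ⟪n x, v x⟫) x₀ a = 0 := by
    have he : (fun x => ⟪n x, v x⟫) =ᶠ[nhds x₀] fun _ => (0 : ℝ) := by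
      filter_upwards [hU.mem_nhds hx₀] with x hx using hv x hx
    rw [he.fderiv_eq]
    simp
  rw [fderiv_inner_apply ℝ hdn hdv] at h0
  have h1 : |⟪n x₀, fderiv ℝ v x₀ a⟫| ≤ ‖fderiv ℝ n x₀ a‖ * ‖v x₀‖ := by
    have h2 : ⟪n x₀, fderiv ℝ v x₀ a⟫ = -⟪fderiv ℝ n x₀ a, v x₀⟫ := by linarith
    rw [h2, abs_neg]
    exact abs_real_inner_le_norm _ _
  have h3 : fderiv ℝ v x₀ a = tangProj (n x₀) (fderiv ℝ v x₀ a)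
      + ⟪n x₀, fderiv ℝ v x₀ a⟫ • n x₀ := by
    simp [tangProj]
  calc ‖fderiv ℝ v x₀ a‖ = ‖tangProj (n x₀) (fderiv ℝ v x₀ a)
      + ⟪n x₀, fderiv ℝ v x₀ a⟫ • n x₀‖ := congrArg _ h3
    _ ≤ ‖tangProj (n x₀) (fderiv ℝ v x₀ a)‖ + ‖⟪n x₀, fderiv ℝ v x₀ a⟫ • n x₀‖ :=
      norm_add_le _ _
    _ ≤ _ := by
      rw [norm_smul, hn x₀ hx₀, mul_one, Real.norm_eq_abs]
      linarith
end
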